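/- Let h ∈ ℕ and let Y = (Y_1^{(1)},…,Y_h^{(1)},Y_1^{(2)},…,Y_h^{(2)}) be an integrable ℝ^{2h}-valued random vector such that −Y has the same distribution as Y and such that, almost surely, for each p ∈ {1,2} the h+1 numbers 0, Y_1^{(p)}, Y_1^{(p)}+Y_2^{(p)}, …, Y_1^{(p)}+⋯+Y_h^{(p)} are pairwise distinct. Then for every coordinate index i ∈ {1,…,2h}, E[Y^{(i)}·1{Π̃(Y_1^{(1)},…,Y_h^{(1)}) = Π̃(Y_1^{(2)},…,Y_h^{(2)})}] = 0. In particular, all first-order Hermite coefficients of the indicator of coincident ordinal patterns vanish, so its Hermite rank is at least 2. -/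

import Mathlib

open MeasureTheory

/-- `π` is the ordinal pattern of `x = (x_0,…,x_m)`: the values `x_{π_0} ≥ … ≥ x_{π_m}` are
ordered decreasingly, with ties broken by `π_{i−1} < π_i` whenever `x_{π_{i−1}} = x_{π_i}`. -/
def IsOrdPat {m : ℕ} (x : Fin (m + 1) → ℝ) (π : Equiv.Perm (Fin (m + 1))) : Prop :=
  (∀ i : Fin m, x (π i.succ) ≤ x (π i.castSucc)) ∧
  (∀ i : Fin m, x (π i.castSucc) = x (π i.succ) → π i.castSucc < π i.succ)

/-- The vector of partial sums `(0, y_1, y_1+y_2, …, y_1+⋯+y_m)` of `y = (y_1,…,y_m)`;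
the map `Π̃` of the paper is `y ↦ Π(cumsum y)`. -/
def cumsum (m : ℕ) (y : Fin m → ℝ) : Fin (m + 1) → ℝ :=
  fun i => ∑ j : Fin m, if (j : ℕ) < (i : ℕ) then y j else 0

theorem IsOrdPat.strictAnti {m : ℕ} {x : Fin (m + 1) → ℝ} {π : Equiv.Perm (Fin (m + 1))}
    (hπ : IsOrdPat x π) (hx : Function.Injective x) : StrictAnti (x ∘ π) :=
  Fin.strictAnti_iff_succ_lt.2 fun i =>
    lt_of_le_of_ne (hπ.1 i) fun e => i.castSucc_lt_succ.ne' (π.injective (hx e))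

/-- Two tie-free vectors have the same ordinal pattern iff their entries compare the same way. -/
theorem IsOrdPat.eq_iff {m : ℕ} {x y : Fin (m + 1) → ℝ} {π σ : Equiv.Perm (Fin (m + 1))}
    (hπ : IsOrdPat x π) (hσ : IsOrdPat y σ) (hx : Function.Injective x)
    (hy : Function.Injective y) : π = σ ↔ ∀ j k, x j < x k ↔ y j < y k := by
  have hπ' := hπ.strictAnti hx
  have hσ' := hσ.strictAnti hy
  constructor
  · rintro rfl j k
    have h₁ := hπ'.lt_iff_gt (a := π.symm j) (b := π.symm k)
    have h₂ := hσ'.lt_iff_gt (a := π.symm j) (b := π.symm k)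
    simp only [Function.comp_apply, Equiv.apply_symm_apply] at h₁ h₂
    exact h₁.trans h₂.symm
  · intro H
    have hyπ : StrictAnti (y ∘ π) := fun a b hab => (H _ _).1 (hπ' hab)
    have e : y ∘ π = y ∘ σ := (hyπ.range_inj hσ').1 <| by
      simp only [Set.range_comp, EquivLike.range_eq_univ]
    exact Equiv.ext fun a => hy (congrFun e a)

theorem cumsum_neg (m : ℕ) (y : Fin m → ℝ) : cumsum m (-y) = -cumsum m y := by
  ext i
  simp only [cumsum, Pi.neg_apply, ← Finset.sum_neg_distrib]
  exact Finset.sum_congr rfl fun j _ => by split_ifs <;> simp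

theorem measurable_cumsum (m : ℕ) : Measurable (cumsum m) := by
  refine measurable_pi_lambda _ fun i => Finset.measurable_sum _ fun j _ => ?_
  split_ifs
  · exact measurable_pi_apply j
  · exact measurable_const

/-- An odd measurable function of a symmetric random variable has mean zero. -/
theorem integral_comp_eq_zero_of_map_neg_eq {Ω E : Type*} [MeasurableSpace Ω] [MeasurableSpace E]
    [Neg E] [MeasurableNeg E] {P : Measure Ω} {Y : Ω → E} (hY : Measurable Y)
    (hsym : Measure.map (fun ω => -(Y ω)) P = Measure.map Y P)
    {g : E → ℝ} (hg : Measurable g) (hodd : ∀ y, g (-y) = -g y) : ∫ ω, g (Y ω) ∂P = 0 := by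
  have h₁ := integral_map (μ := P) hY.aemeasurable hg.aestronglyMeasurable
  have h₂ := integral_map (μ := P) hY.neg.aemeasurable hg.aestronglyMeasurable
  have h₃ : ∫ ω, g (-(Y ω)) ∂P = -∫ ω, g (Y ω) ∂P := by
    simp only [hodd, integral_neg]
  have h₄ : ∫ ω, g (-(Y ω)) ∂P = ∫ ω, g (Y ω) ∂P := by
    rw [← h₁, ← hsym]
    exact h₂.symm
  linarith

/-- let `Y = (Y_1^{(1)},…,Y_h^{(1)},Y_1^{(2)},…,Y_h^{(2)})` be an integrable
random vector with `−Y ≅ Y` in distribution, whose two blocks a.s. have tie-free partial-sum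
vectors.  Then for every coordinate `Y^{(i)}` of `Y`,
`E[Y^{(i)}·1{Π̃(Y^{(1)}) = Π̃(Y^{(2)})}] = 0`: all first-order Hermite coefficients of the
indicator of coincident ordinal patterns vanish.
`Pat` is the ordinal pattern map `Π`, characterized by `hPat`, and `Π̃ y = Pat (cumsum y)`. -/
theorem pattern_indicator_first_hermite_coefficients_vanish
    {Ω : Type*} [MeasurableSpace Ω] (P : Measure Ω) [IsProbabilityMeasure P]
    (Pat : ∀ m : ℕ, (Fin (m + 1) → ℝ) → Equiv.Perm (Fin (m + 1)))
    (hPat : ∀ (m : ℕ) (x : Fin (m + 1) → ℝ), IsOrdPat x (Pat m x))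
    (h : ℕ) (Y : Ω → Fin 2 → Fin h → ℝ)
    (hmeas : Measurable Y)
    (hint : ∀ (p : Fin 2) (i : Fin h), Integrable (fun ω => Y ω p i) P)
    (hsym : Measure.map (fun ω => -(Y ω)) P = Measure.map Y P)
    (hties : ∀ᵐ ω ∂P, ∀ p : Fin 2, Function.Injective (cumsum h (Y ω p)))
    (p : Fin 2) (i : Fin h) :
    ∫ ω, (if Pat h (cumsum h (Y ω 0)) = Pat h (cumsum h (Y ω 1))
        then Y ω p i else 0) ∂P = 0 := by
  classical
  let C : Set (Fin 2 → Fin h → ℝ) :=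
    {y | ∀ j k, cumsum h (y 0) j < cumsum h (y 0) k ↔ cumsum h (y 1) j < cumsum h (y 1) k}
  have hC : MeasurableSet C := by
    have hc (q : Fin 2) (j : Fin (h + 1)) :
        Measurable fun y : Fin 2 → Fin h → ℝ => cumsum h (y q) j :=
      (measurable_pi_apply j).comp ((measurable_cumsum h).comp (measurable_pi_apply q))
    exact measurableSet_setOfPred.2 <| Measurable.forall fun j => Measurable.forall fun k =>
      (measurableSet_setOfPred.1 (measurableSet_lt (hc 0 j) (hc 0 k))).iff
        (measurableSet_setOfPred.1 (measurableSet_lt (hc 1 j) (hc 1 k)))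
  have hCneg (y : Fin 2 → Fin h → ℝ) : -y ∈ C ↔ y ∈ C := by
    simp only [C, Set.mem_ofPred_eq, Pi.neg_apply y, cumsum_neg]
    simp only [Pi.neg_apply, neg_lt_neg_iff]
    exact forall_comm
  let g : (Fin 2 → Fin h → ℝ) → ℝ := fun y => if y ∈ C then y p i else 0
  have hg : Measurable g :=
    Measurable.ite hC ((measurable_pi_apply i).comp (measurable_pi_apply p)) measurable_const
  have hodd (y : Fin 2 → Fin h → ℝ) : g (-y) = -g y := by
    simp only [g, hCneg]
    split_ifs <;> simp
  refine (integral_congr_ae ?_).trans (integral_comp_eq_zero_of_map_neg_eq hmeas hsym hg hodd)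
  filter_upwards [hties] with ω hω
  exact if_congr ((hPat h _).eq_iff (hPat h _) (hω 0) (hω 1)) rfl rfl
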